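/- arXiv:1801.04745 — 2 statements merged into one kernel-verified Lean document; each statement's English description precedes it below -/
import Mathlib

section
/- Under Slater's condition for system (2.3), the S-robust one-stage problem max_{π ∈ Δ(A)} inf_{P∈G} E_P[r̃^⊤π + p̃^⊤Vπ] has the same optimal value as the classical robust optimization problem: maximize −δ over π ∈ Δ(A), δ ∈ ℝ, α ∈ ℝ^N, β_j ∈ ℝ^d, γ_j ∈ ℝ^{M_j}_+ (j ∈ [J]) subject to (i) δ ≥ α^⊤ω + Σ_{j∈[J]} (β_j^⊤μ_j + γ_j^⊤ν_j) for all (μ, ν, ω) ∈ V, where V = {(μ, ν, ω) : ω ∈ W, (μ_j, ν_j)/(Σ_{i∈N_j} ω_i) ∈ U_j for all j ∈ [J]}, and (ii) α_n + Σ_{j∈J_n} (β_j^⊤(p, r) + γ_j^⊤ g_{jn}(p, r)) ≥ −r^⊤π − p^⊤Vπ for all (p, r) ∈ D_n and all n ∈ [N]; moreover the π-component of any optimal solution of the latter problem is an optimal π for the former. -/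
open MeasureTheory Finset ENNReal

noncomputable section

/-- `ℝ^{I₁} × ℝ^{I₂}`, the space in which the uncertain parameters `(p̃, r̃)` live. -/
abbrev DVec (I1 I2 : ℕ) : Type := (Fin I1 → ℝ) × (Fin I2 → ℝ)

/-- The lifted outcome space `ℝ^{I₁} × ℝ^{I₂} × [N]` for `(p̃, r̃, ñ)`. -/
abbrev AmbParam (I1 I2 N : ℕ) : Type := (Fin I1 → ℝ) × (Fin I2 → ℝ) × Fin N

variable {I1 I2 N J : ℕ}

/-- The lifted ambiguity set `G` in the general format (2.2): `P ∈ G` iff there exist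
`ω ∈ W` and `(μ_j, ν_j) ∈ U_j` such that `E_P[(p̃,r̃) | ñ ∈ N_j] = μ_j`,
`E_P[g_{jñ}(p̃,r̃) | ñ ∈ N_j] ≤ ν_j` (the conditional expectations being expressed as set
integrals against `P(ñ ∈ N_j) = Σ_{i∈N_j} ω_i`), `P((p̃,r̃) ∈ D_n | ñ = n) = 1` and
`P(ñ = n) = ω_n`. -/
def GeneralFormat (M : Fin J → ℕ) (Nsets : Fin J → Finset (Fin N))
    (g : (j : Fin J) → Fin N → DVec I1 I2 → Fin (M j) → ℝ)
    (D : Fin N → Set (DVec I1 I2))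
    (U : (j : Fin J) → Set (DVec I1 I2 × (Fin (M j) → ℝ)))
    (W : Set (Fin N → ℝ)) : Set (ProbabilityMeasure (AmbParam I1 I2 N)) :=
  {P | ∃ ω ∈ W, ∃ μ : (j : Fin J) → DVec I1 I2, ∃ ν : (j : Fin J) → Fin (M j) → ℝ,
      (∀ j, (μ j, ν j) ∈ U j) ∧
      (∀ j, (∀ i, ∫ y in {y : AmbParam I1 I2 N | y.2.2 ∈ Nsets j}, y.1 i
                ∂(P : Measure (AmbParam I1 I2 N))
              = (∑ i' ∈ Nsets j, ω i') * (μ j).1 i) ∧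
            (∀ a, ∫ y in {y : AmbParam I1 I2 N | y.2.2 ∈ Nsets j}, y.2.1 a
                ∂(P : Measure (AmbParam I1 I2 N))
              = (∑ i' ∈ Nsets j, ω i') * (μ j).2 a)) ∧
      (∀ j, ∀ m, ∫ y in {y : AmbParam I1 I2 N | y.2.2 ∈ Nsets j}, g j y.2.2 (y.1, y.2.1) m
              ∂(P : Measure (AmbParam I1 I2 N))
            ≤ (∑ i' ∈ Nsets j, ω i') * ν j m) ∧
      (∀ n, (P : Measure (AmbParam I1 I2 N)) {y | y.2.2 = n ∧ (y.1, y.2.1) ∈ D n}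
              = ENNReal.ofReal (ω n)) ∧
      (∀ n, (P : Measure (AmbParam I1 I2 N)) {y | y.2.2 = n} = ENNReal.ofReal (ω n))}

/-- Standing assumptions on the data of the general format (2.2): the scenario subsets
`N_j` are nonempty, the `g_{jn}` are convex and lower semicontinuous, the `D_n` and `U_j`
are nonempty closed convex compact, and `W` is a nonempty convex compact subset of the
relative interior of the probability simplex. -/
def GFAssumptions (M : Fin J → ℕ) (Nsets : Fin J → Finset (Fin N))
    (g : (j : Fin J) → Fin N → DVec I1 I2 → Fin (M j) → ℝ)
    (D : Fin N → Set (DVec I1 I2))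
    (U : (j : Fin J) → Set (DVec I1 I2 × (Fin (M j) → ℝ)))
    (W : Set (Fin N → ℝ)) : Prop :=
  (∀ j, (Nsets j).Nonempty) ∧
  (∀ j n m, ConvexOn ℝ Set.univ (fun x => g j n x m)) ∧
  (∀ j n m, LowerSemicontinuous (fun x => g j n x m)) ∧
  (∀ n, (D n).Nonempty ∧ IsClosed (D n) ∧ Convex ℝ (D n) ∧ IsCompact (D n)) ∧
  (∀ j, (U j).Nonempty ∧ IsClosed (U j) ∧ Convex ℝ (U j) ∧ IsCompact (U j)) ∧
  (W.Nonempty ∧ Convex ℝ W ∧ IsCompact W ∧ ∀ ωv ∈ W, (∀ n, 0 < ωv n) ∧ ∑ n, ωv n = 1)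

/-- `β^⊤(p, r)`: the inner product on `ℝ^{I₁} × ℝ^{I₂}`. -/
def dotD (u v : DVec I1 I2) : ℝ := ∑ i, u.1 i * v.1 i + ∑ a, u.2 a * v.2 a

/-- The bilinear payoff `r̃^⊤π + p̃^⊤Vπ`. -/
def payoff (V : Matrix (Fin I1) (Fin I2) ℝ) (π : Fin I2 → ℝ) (y : AmbParam I1 I2 N) : ℝ :=
  (∑ a, y.2.1 a * π a) + ∑ i, y.1 i * ∑ a, V i a * π a

/-- The optimal value of the S-robust one-stage problem
`max_{π∈Δ(A)} inf_{P∈G} E_P[r̃^⊤π + p̃^⊤Vπ]`. -/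
def primalValue (M : Fin J → ℕ) (Nsets : Fin J → Finset (Fin N))
    (g : (j : Fin J) → Fin N → DVec I1 I2 → Fin (M j) → ℝ)
    (D : Fin N → Set (DVec I1 I2))
    (U : (j : Fin J) → Set (DVec I1 I2 × (Fin (M j) → ℝ)))
    (W : Set (Fin N → ℝ)) (V : Matrix (Fin I1) (Fin I2) ℝ) : ℝ :=
  ⨆ π : stdSimplex ℝ (Fin I2), ⨅ P : GeneralFormat M Nsets g D U W,
    ∫ y, payoff V (π : Fin I2 → ℝ) y
      ∂((P : ProbabilityMeasure (AmbParam I1 I2 N)) : Measure (AmbParam I1 I2 N))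

/-- Feasibility for the classical robust optimization reformulation (3.2): constraint (i)
ranges over the uncertainty set `V = {(μ,ν,ω) : ω ∈ W, (μ_j,ν_j)/ω̄_j ∈ U_j}` and
constraint (ii) over the supports `D_n`. -/
def RobustFeas (M : Fin J → ℕ) (Nsets : Fin J → Finset (Fin N))
    (g : (j : Fin J) → Fin N → DVec I1 I2 → Fin (M j) → ℝ)
    (D : Fin N → Set (DVec I1 I2))
    (U : (j : Fin J) → Set (DVec I1 I2 × (Fin (M j) → ℝ)))
    (W : Set (Fin N → ℝ)) (V : Matrix (Fin I1) (Fin I2) ℝ)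
    (π : Fin I2 → ℝ) (δ : ℝ) (α : Fin N → ℝ)
    (β : Fin J → DVec I1 I2) (γv : (j : Fin J) → Fin (M j) → ℝ) : Prop :=
  π ∈ stdSimplex ℝ (Fin I2) ∧ (∀ j m, 0 ≤ γv j m) ∧
    (∀ ωv ∈ W, ∀ (μ : (j : Fin J) → DVec I1 I2) (ν : (j : Fin J) → Fin (M j) → ℝ),
      (∀ j, ((∑ i ∈ Nsets j, ωv i)⁻¹ • μ j, (∑ i ∈ Nsets j, ωv i)⁻¹ • ν j) ∈ U j) →
      (∑ n, α n * ωv n) + ∑ j, (dotD (β j) (μ j) + ∑ m, γv j m * ν j m) ≤ δ) ∧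
    (∀ n : Fin N, ∀ x ∈ D n,
      -payoff V π (x.1, x.2, n) ≤
        α n + ∑ j ∈ univ.filter (fun j : Fin J => n ∈ Nsets j),
          (dotD (β j) x + ∑ m, γv j m * g j n x m))

/-- The optimal value of the robust reformulation (3.2): maximize `−δ` over feasible
`(π, δ, α, β, γ)`. -/
def dualValue (M : Fin J → ℕ) (Nsets : Fin J → Finset (Fin N))
    (g : (j : Fin J) → Fin N → DVec I1 I2 → Fin (M j) → ℝ)
    (D : Fin N → Set (DVec I1 I2))
    (U : (j : Fin J) → Set (DVec I1 I2 × (Fin (M j) → ℝ)))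
    (W : Set (Fin N → ℝ)) (V : Matrix (Fin I1) (Fin I2) ℝ) : ℝ :=
  sSup {x : ℝ | ∃ π δ α β γv, RobustFeas M Nsets g D U W V π δ α β γv ∧ x = -δ}

/-- The variable space of system (2.3): `(τ, ξ, ζ, (φ_j, ϕ_j)_j)`. -/
abbrev SlaterSpace (I1 I2 N J : ℕ) (M : Fin J → ℕ) : Type :=
  (Fin N → ℝ) × (Fin N → DVec I1 I2) × ((j : Fin J) → Fin N → Fin (M j) → ℝ)
    × ((j : Fin J) → DVec I1 I2 × (Fin (M j) → ℝ))

/-- The feasible region of the conic system (2.3). -/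
def SlaterSystem (M : Fin J → ℕ) (Nsets : Fin J → Finset (Fin N))
    (g : (j : Fin J) → Fin N → DVec I1 I2 → Fin (M j) → ℝ)
    (D : Fin N → Set (DVec I1 I2))
    (U : (j : Fin J) → Set (DVec I1 I2 × (Fin (M j) → ℝ)))
    (W : Set (Fin N → ℝ)) : Set (SlaterSpace I1 I2 N J M) :=
  {x | x.1 ∈ W ∧
    (∀ j, ∑ n ∈ Nsets j, x.2.1 n = (x.2.2.2 j).1) ∧
    (∀ j, ∀ m, ∑ n ∈ Nsets j, x.2.2.1 j n m ≤ (x.2.2.2 j).2 m) ∧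
    (∀ n : Fin N, ∀ j, n ∈ Nsets j →
      ∀ m, g j n ((x.1 n)⁻¹ • x.2.1 n) m ≤ (x.1 n)⁻¹ * x.2.2.1 j n m) ∧
    (∀ n : Fin N, (x.1 n)⁻¹ • x.2.1 n ∈ D n) ∧
    (∀ j, (∑ i ∈ Nsets j, x.1 i)⁻¹ • x.2.2.2 j ∈ U j)}

/-- The image space used in the separation argument. -/
abbrev SepSpace (I1 I2 J : ℕ) (M : Fin J → ℕ) : Type :=
  ℝ × (Fin J → DVec I1 I2) × ((j : Fin J) → Fin (M j) → ℝ)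

theorem aux_lin_pi {ι : Type*} [Fintype ι] [DecidableEq ι] (f : (ι → ℝ) →ₗ[ℝ] ℝ) (x : ι → ℝ) :
    f x = ∑ i, f (Pi.single i 1) * x i := by
  conv_lhs => rw [← LinearMap.sum_single_apply (fun _ : ι => ℝ) x]
  rw [map_sum]
  refine Finset.sum_congr rfl fun i _ => ?_
  have : (Pi.single i (x i) : ι → ℝ) = x i • Pi.single i 1 := by
    rw [← Pi.single_smul]; simp
  rw [this, map_smul, smul_eq_mul, mul_comm]

theorem aux_lin_dec (M : Fin J → ℕ) (f : SepSpace I1 I2 J M →ₗ[ℝ] ℝ) (z : SepSpace I1 I2 J M) :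
    f z = z.1 * f (1, 0, 0) + ∑ j, ((∑ i, f (0, Pi.single j (Pi.single i 1, 0), 0) * (z.2.1 j).1 i +
      ∑ i, f (0, Pi.single j (0, Pi.single i 1), 0) * (z.2.1 j).2 i) +
      ∑ m, f (0, 0, Pi.single j (Pi.single m 1)) * z.2.2 j m) := by
  have hz : z = z.1 • ((1, 0, 0) : SepSpace I1 I2 J M) + ((0, z.2.1, 0) + (0, 0, z.2.2)) := by
    refine Prod.ext ?_ (Prod.ext ?_ ?_) <;> simp
  conv_lhs => rw [hz]
  rw [map_add, map_add, map_smul, smul_eq_mul, Finset.sum_add_distrib]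
  congr 2
  · have := congrArg (fun a => f (0, a, 0))
      (LinearMap.sum_single_apply (fun _ : Fin J => DVec I1 I2) z.2.1)
    rw [← this]
    let F : (Fin J → DVec I1 I2) →ₗ[ℝ] ℝ := f ∘ₗ LinearMap.inr ℝ _ _ ∘ₗ LinearMap.inl ℝ _ _
    change F (∑ j, Pi.single j (z.2.1 j)) = _
    rw [map_sum]
    refine Finset.sum_congr rfl fun j _ => ?_
    let G : DVec I1 I2 →ₗ[ℝ] ℝ := F ∘ₗ LinearMap.single ℝ (fun _ : Fin J => DVec I1 I2) j
    change G (z.2.1 j) = _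
    have h : z.2.1 j = ((z.2.1 j).1, 0) + (0, (z.2.1 j).2) := by simp
    conv_lhs => rw [h]
    rw [map_add]
    congr 1
    · exact aux_lin_pi (G ∘ₗ LinearMap.inl ℝ _ _) _
    · exact aux_lin_pi (G ∘ₗ LinearMap.inr ℝ _ _) _
  · have := congrArg (fun a => f (0, 0, a))
      (LinearMap.sum_single_apply (fun j : Fin J => Fin (M j) → ℝ) z.2.2)
    rw [← this]
    let F : ((j : Fin J) → Fin (M j) → ℝ) →ₗ[ℝ] ℝ :=
      f ∘ₗ LinearMap.inr ℝ _ _ ∘ₗ LinearMap.inr ℝ _ _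
    change F (∑ j, Pi.single j (z.2.2 j)) = _
    rw [map_sum]
    refine Finset.sum_congr rfl fun j _ => ?_
    exact aux_lin_pi (F ∘ₗ LinearMap.single ℝ (fun j : Fin J => Fin (M j) → ℝ) j) _

open scoped Pointwise in
/-- Separation argument behind strong duality. -/
theorem aux_sep {X : Type*} [TopologicalSpace X] (M : Fin J → ℕ) (K : Set X) (hK : IsCompact K)
    (T : X → ℝ) (A : X → Fin J → DVec I1 I2) (B : X → (j : Fin J) → Fin (M j) → ℝ)
    (hT : Continuous T) (hA : Continuous A) (hB : Continuous B)
    (hconv : ∀ k ∈ K, ∀ k' ∈ K, ∀ s s' : ℝ, 0 ≤ s → 0 ≤ s' → s + s' = 1 →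
      ∃ k'' ∈ K, T k'' ≤ s * T k + s' * T k' ∧ A k'' = s • A k + s' • A k' ∧
        B k'' ≤ s • B k + s' • B k')
    (k0 : X) (hk0 : k0 ∈ K) (hA0 : A k0 = 0) (hB0 : B k0 ≤ 0) (t : ℝ)
    (ht : ∀ k ∈ K, A k = 0 → B k ≤ 0 → t < T k) :
    ∃ (β : Fin J → DVec I1 I2) (γ : (j : Fin J) → Fin (M j) → ℝ), (∀ j m, 0 ≤ γ j m) ∧
      ∀ k ∈ K, t ≤ T k + ∑ j, (dotD (β j) (A k j) + ∑ m, γ j m * B k j m) := by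
  classical
  let C : Set (SepSpace I1 I2 J M) := {z | 0 ≤ z.1 ∧ z.2.1 = 0 ∧ 0 ≤ z.2.2}
  let Φ : X → SepSpace I1 I2 J M := fun k => (T k, A k, B k)
  let S : Set (SepSpace I1 I2 J M) := Φ '' K + C
  have hC : IsClosed C := by
    refine (isClosed_le continuous_const continuous_fst).inter
      ((isClosed_eq (f := fun z : SepSpace I1 I2 J M => z.2.1) (by fun_prop) continuous_const).inter
        (isClosed_le (g := fun z : SepSpace I1 I2 J M => z.2.2) continuous_const (by fun_prop)))
  have hS : IsClosed S :=
    IsClosed.add_left_of_isCompact hC (hK.image (hT.prodMk (hA.prodMk hB)))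
  have memS : ∀ z : SepSpace I1 I2 J M, z ∈ S ↔ ∃ k ∈ K, T k ≤ z.1 ∧ A k = z.2.1 ∧ B k ≤ z.2.2 := by
    intro z
    constructor
    · rintro ⟨_, ⟨k, hk, rfl⟩, c, ⟨h1, h2, h3⟩, rfl⟩
      refine ⟨k, hk, ?_, ?_, ?_⟩
      · simpa [Φ] using h1
      · simp [Φ, h2]
      · simpa [Φ] using h3
    · rintro ⟨k, hk, h1, h2, h3⟩
      refine ⟨Φ k, ⟨k, hk, rfl⟩, z - Φ k, ⟨?_, ?_, ?_⟩, by simp⟩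
      · simpa [Φ] using h1
      · simp [Φ, h2]
      · simpa [Φ] using h3
  have hcS : Convex ℝ S := by
    intro z hz z' hz' s s' hs hs' hss
    rw [memS] at hz hz' ⊢
    obtain ⟨k, hk, h1, h2, h3⟩ := hz
    obtain ⟨k', hk', h1', h2', h3'⟩ := hz'
    obtain ⟨k'', hk'', h1'', h2'', h3''⟩ := hconv k hk k' hk' s s' hs hs' hss
    refine ⟨k'', hk'', ?_, ?_, ?_⟩
    · refine h1''.trans ?_
      simp only [Prod.fst_add, Prod.smul_fst, smul_eq_mul]
      gcongr
    · rw [h2'', h2, h2']; rfl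
    · refine h3''.trans ?_
      simp only [Prod.snd_add, Prod.smul_snd]
      gcongr
  have hnot : ((t, 0, 0) : SepSpace I1 I2 J M) ∉ S := by
    rw [memS]
    rintro ⟨k, hk, h1, h2, h3⟩
    exact absurd (ht k hk h2 h3) (not_lt.mpr h1)
  obtain ⟨f, u, hfu, hf⟩ := geometric_hahn_banach_point_closed hcS hS hnot
  set l : ℝ := f (1, 0, 0) with hl
  have hft : ∀ s : ℝ, f (s, 0, 0) = s * l := by
    intro s
    have : ((s, 0, 0) : SepSpace I1 I2 J M) = s • ((1, 0, 0) : SepSpace I1 I2 J M) := by ext <;> simp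
    rw [this, map_smul]; rfl
  -- recession
  have hrec : ∀ c ∈ C, 0 ≤ f c := by
    intro c hc
    by_contra hneg
    push Not at hneg
    have key : ∀ s : ℝ, 0 ≤ s → u < f (Φ k0) + s * f c := by
      intro s hs
      have := hf (Φ k0 + s • c) ⟨Φ k0, ⟨k0, hk0, rfl⟩, s • c, ⟨?_, ?_, ?_⟩, rfl⟩
      · rwa [map_add, map_smul] at this
      · exact mul_nonneg hs hc.1
      · simp [hc.2.1]
      · exact smul_nonneg hs hc.2.2
    have h0 := key 0 le_rfl
    have := key ((f (Φ k0) - u) / (- f c)) (div_nonneg (by linarith) (by linarith))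
    rw [div_mul_eq_mul_div, div_neg, mul_div_assoc, div_self hneg.ne] at this
    linarith
  have hl0 : 0 ≤ l := hrec _ ⟨zero_le_one, rfl, le_rfl⟩
  have hlpos : 0 < l := by
    have h1 := hf (T k0, 0, 0) ((memS _).2 ⟨k0, hk0, le_rfl, hA0, hB0⟩)
    rw [hft] at hfu h1
    rcases hl0.lt_or_eq with h | h
    · exact h
    · rw [← h] at hfu h1; linarith
  let eA1 : Fin J → Fin I1 → SepSpace I1 I2 J M := fun j i => (0, Pi.single j (Pi.single i 1, 0), 0)
  let eA2 : Fin J → Fin I2 → SepSpace I1 I2 J M := fun j i => (0, Pi.single j (0, Pi.single i 1), 0)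
  let eB : (j : Fin J) → Fin (M j) → SepSpace I1 I2 J M := fun j m => (0, 0, Pi.single j (Pi.single m 1))
  have hdec : ∀ z : SepSpace I1 I2 J M, f z = z.1 * l + ∑ j, ((∑ i, f (eA1 j i) * (z.2.1 j).1 i +
      ∑ i, f (eA2 j i) * (z.2.1 j).2 i) + ∑ m, f (eB j m) * z.2.2 j m) := by
    intro z
    exact aux_lin_dec M f.toLinearMap z
  refine ⟨fun j => (fun i => f (eA1 j i) / l, fun i => f (eA2 j i) / l),
    fun j m => f (eB j m) / l, ?_, ?_⟩
  · intro j m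
    refine div_nonneg (hrec _ ⟨le_rfl, rfl, ?_⟩) hl0
    exact Pi.single_nonneg.2 (Pi.single_nonneg.2 zero_le_one)
  · intro k hk
    have h1 := hf (Φ k) ((memS _).2 ⟨k, hk, le_rfl, rfl, le_rfl⟩)
    rw [hft] at hfu
    rw [hdec] at h1
    have h2 := hfu.trans h1
    have h3 : t * l ≤ (T k + ∑ j, (dotD (fun i => f (eA1 j i) / l, fun i => f (eA2 j i) / l) (A k j)
        + ∑ m, f (eB j m) / l * B k j m)) * l := by
      refine h2.le.trans (le_of_eq ?_)
      rw [add_mul, Finset.sum_mul]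
      congr 1
      refine Finset.sum_congr rfl fun j _ => ?_
      simp only [dotD, add_mul, Finset.sum_mul]
      congr 1
      · congr 1
        all_goals
          refine Finset.sum_congr rfl fun i _ => ?_
          field_simp
          rfl
      · refine Finset.sum_congr rfl fun i _ => ?_
        field_simp
        rfl
    exact le_of_mul_le_mul_right h3 hlpos

theorem aux_swap (Nsets : Fin J → Finset (Fin N)) (ω : Fin N → ℝ) (F : Fin J → Fin N → ℝ) :
    ∑ n, ω n * ∑ j ∈ univ.filter (fun j : Fin J => n ∈ Nsets j), F j n =
      ∑ j, ∑ n ∈ Nsets j, ω n * F j n := by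
  simp only [Finset.mul_sum]
  exact Finset.sum_comm' (by simp)

theorem aux_comb {E : Type*} [AddCommGroup E] [Module ℝ E] {a b : ℝ} (h : 0 < a + b) (x y : E) :
    (a + b) • ((a / (a + b)) • x + (b / (a + b)) • y) = a • x + b • y := by
  rw [smul_add, smul_smul, smul_smul, mul_div_cancel₀ _ h.ne', mul_div_cancel₀ _ h.ne']

theorem aux_comb_le {E : Type*} [AddCommGroup E] [Module ℝ E] {f : E → ℝ}
    (hf : ConvexOn ℝ Set.univ f) {a b : ℝ} (ha : 0 ≤ a) (hb : 0 ≤ b) (h : 0 < a + b) (x y : E) :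
    (a + b) * f ((a / (a + b)) • x + (b / (a + b)) • y) ≤ a * f x + b * f y := by
  have h1 := hf.2 (Set.mem_univ x) (Set.mem_univ y) (div_nonneg ha h.le) (div_nonneg hb h.le)
    (by rw [← add_div, div_self h.ne'])
  have h2 := mul_le_mul_of_nonneg_left h1 h.le
  rwa [← smul_eq_mul (a + b) (_ + _), aux_comb h] at h2

/-- payoff as a linear functional of the parameters -/
theorem aux_payoff_comb (V : Matrix (Fin I1) (Fin I2) ℝ) (π : Fin I2 → ℝ) (n : Fin N)
    (a b : ℝ) (x y : DVec I1 I2) :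
    payoff V π ((a • x + b • y).1, (a • x + b • y).2, n)
      = a * payoff V π (x.1, x.2, n) + b * payoff V π (y.1, y.2, n) := by
  simp only [payoff, Prod.fst_add, Prod.snd_add, Prod.smul_fst, Prod.smul_snd, Pi.add_apply,
    Pi.smul_apply, smul_eq_mul, mul_add, Finset.mul_sum, add_mul, Finset.sum_add_distrib]
  simp only [mul_assoc]
  ring

theorem aux_cont_payoff (V : Matrix (Fin I1) (Fin I2) ℝ) (π : Fin I2 → ℝ) (n : Fin N) :
    Continuous (fun x : DVec I1 I2 => payoff V π (x.1, x.2, n)) := by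
  unfold payoff
  fun_prop

theorem aux_dotD_smul (u v : DVec I1 I2) (c : ℝ) : dotD u (c • v) = c * dotD u v := by
  simp only [dotD, Prod.smul_fst, Prod.smul_snd, Pi.smul_apply, smul_eq_mul, mul_add,
    Finset.mul_sum]
  congr 1 <;> exact Finset.sum_congr rfl fun i _ => by ring

theorem aux_dotD_add (u v w : DVec I1 I2) : dotD u (v + w) = dotD u v + dotD u w := by
  simp only [dotD, Prod.fst_add, Prod.snd_add, Pi.add_apply, mul_add, Finset.sum_add_distrib]
  ring

theorem aux_dotD_sub (u v w : DVec I1 I2) : dotD u (v - w) = dotD u v - dotD u w := by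
  have := aux_dotD_add u (v - w) w
  rw [sub_add_cancel] at this
  linarith

theorem aux_dotD_sum {ι : Type*} (s : Finset ι) (u : DVec I1 I2) (v : ι → DVec I1 I2) :
    dotD u (∑ i ∈ s, v i) = ∑ i ∈ s, dotD u (v i) := by
  classical
  induction s using Finset.induction_on with
  | empty => simp [dotD]
  | insert a s ha ih => rw [Finset.sum_insert ha, Finset.sum_insert ha, aux_dotD_add, ih]

theorem aux_cont_dotD (u : DVec I1 I2) : Continuous (fun x : DVec I1 I2 => dotD u x) := by
  unfold dotD
  fun_prop

/-- points of the finite dimensional primal -/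
abbrev PSpace (I1 I2 N J : ℕ) (M : Fin J → ℕ) : Type :=
  (Fin N → ℝ) × (Fin N → DVec I1 I2) × ((j : Fin J) → DVec I1 I2 × (Fin (M j) → ℝ))

def Kset (M : Fin J → ℕ)
    (D : Fin N → Set (DVec I1 I2))
    (U : (j : Fin J) → Set (DVec I1 I2 × (Fin (M j) → ℝ)))
    (W : Set (Fin N → ℝ)) : Set (PSpace I1 I2 N J M) :=
  W ×ˢ (Set.pi Set.univ D) ×ˢ (Set.pi Set.univ U)

def Tfun (M : Fin J → ℕ) (V : Matrix (Fin I1) (Fin I2) ℝ) (π : Fin I2 → ℝ)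
    (k : PSpace I1 I2 N J M) : ℝ :=
  ∑ n, k.1 n * payoff V π ((k.2.1 n).1, (k.2.1 n).2, n)

def Afun (M : Fin J → ℕ) (Nsets : Fin J → Finset (Fin N))
    (k : PSpace I1 I2 N J M) (j : Fin J) : DVec I1 I2 :=
  ∑ n ∈ Nsets j, k.1 n • k.2.1 n - (∑ n ∈ Nsets j, k.1 n) • (k.2.2 j).1

def Bfun (M : Fin J → ℕ) (Nsets : Fin J → Finset (Fin N))
    (g : (j : Fin J) → Fin N → DVec I1 I2 → Fin (M j) → ℝ)
    (k : PSpace I1 I2 N J M) (j : Fin J) (m : Fin (M j)) : ℝ :=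
  ∑ n ∈ Nsets j, k.1 n * g j n (k.2.1 n) m - (∑ n ∈ Nsets j, k.1 n) * (k.2.2 j).2 m

theorem aux_Kconv (M : Fin J → ℕ) (Nsets : Fin J → Finset (Fin N))
    (g : (j : Fin J) → Fin N → DVec I1 I2 → Fin (M j) → ℝ)
    (D : Fin N → Set (DVec I1 I2))
    (U : (j : Fin J) → Set (DVec I1 I2 × (Fin (M j) → ℝ)))
    (W : Set (Fin N → ℝ)) (V : Matrix (Fin I1) (Fin I2) ℝ)
    (hassum : GFAssumptions M Nsets g D U W) (π : Fin I2 → ℝ)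
    (k : PSpace I1 I2 N J M) (hk : k ∈ Kset M D U W)
    (k' : PSpace I1 I2 N J M) (hk' : k' ∈ Kset M D U W)
    (s s' : ℝ) (hs : 0 ≤ s) (hs' : 0 ≤ s') (hss : s + s' = 1) :
    ∃ k'' ∈ Kset M D U W, Tfun M V π k'' ≤ s * Tfun M V π k + s' * Tfun M V π k' ∧
      Afun M Nsets k'' = s • Afun M Nsets k + s' • Afun M Nsets k' ∧
      Bfun M Nsets g k'' ≤ s • Bfun M Nsets g k + s' • Bfun M Nsets g k' := by
  obtain ⟨hN, hg, -, hD, hU, -, hWc, -, hW⟩ := hassum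
  obtain ⟨ω, x, u⟩ := k
  obtain ⟨ω', x', u'⟩ := k'
  obtain ⟨hω, hx, hu⟩ := hk
  obtain ⟨hω', hx', hu'⟩ := hk'
  simp only at hω hω' hx hx' hu hu'
  have pos : ∀ p q : ℝ, 0 < p → 0 < q → 0 < s * p + s' * q := by
    intro p q hp hq
    rcases hs.lt_or_eq with h | h
    · have := mul_pos h hp
      have := mul_nonneg hs' hq.le
      linarith
    · have : s' = 1 := by linarith
      subst h; subst this; simpa using hq
  have hωp := (hW ω hω).1
  have hωp' := (hW ω' hω').1
  have p1 : ∀ n, 0 < s * ω n + s' * ω' n := fun n => pos _ _ (hωp n) (hωp' n)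
  have q1 : ∀ j, 0 < ∑ n ∈ Nsets j, ω n := fun j => Finset.sum_pos (fun n _ => hωp n) (hN j)
  have q1' : ∀ j, 0 < ∑ n ∈ Nsets j, ω' n := fun j => Finset.sum_pos (fun n _ => hωp' n) (hN j)
  have p2 : ∀ j, 0 < s * (∑ n ∈ Nsets j, ω n) + s' * ∑ n ∈ Nsets j, ω' n :=
    fun j => pos _ _ (q1 j) (q1' j)
  have hsum : ∀ j, ∑ n ∈ Nsets j, (s • ω + s' • ω') n
      = s * (∑ n ∈ Nsets j, ω n) + s' * ∑ n ∈ Nsets j, ω' n := by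
    intro j
    simp [Finset.sum_add_distrib, Finset.mul_sum]
  set x'' : Fin N → DVec I1 I2 := fun n => ((s * ω n) / (s * ω n + s' * ω' n)) • x n +
    ((s' * ω' n) / (s * ω n + s' * ω' n)) • x' n with hx''
  set u'' : (j : Fin J) → DVec I1 I2 × (Fin (M j) → ℝ) := fun j =>
    ((s * ∑ n ∈ Nsets j, ω n) / (s * (∑ n ∈ Nsets j, ω n) + s' * ∑ n ∈ Nsets j, ω' n)) • u j +
    ((s' * ∑ n ∈ Nsets j, ω' n) / (s * (∑ n ∈ Nsets j, ω n) + s' * ∑ n ∈ Nsets j, ω' n)) • u' j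
    with hu''
  have hxx : ∀ n, (s • ω + s' • ω') n • x'' n = (s * ω n) • x n + (s' * ω' n) • x' n :=
    fun n => aux_comb (p1 n) _ _
  have huu : ∀ j, (∑ n ∈ Nsets j, (s • ω + s' • ω') n) • u'' j =
      (s * ∑ n ∈ Nsets j, ω n) • u j + (s' * ∑ n ∈ Nsets j, ω' n) • u' j := by
    intro j
    rw [hsum]
    exact aux_comb (p2 j) _ _
  refine ⟨(s • ω + s' • ω', x'', u''), ⟨?_, ?_, ?_⟩, ?_, ?_, ?_⟩
  · exact hWc hω hω' hs hs' hss
  · intro n _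
    exact convex_iff_div.1 (hD n).2.2.1 (hx n trivial) (hx' n trivial)
      (mul_nonneg hs (hωp n).le) (mul_nonneg hs' (hωp' n).le) (p1 n)
  · intro j _
    exact convex_iff_div.1 (hU j).2.2.1 (hu j trivial) (hu' j trivial)
      (mul_nonneg hs (q1 j).le) (mul_nonneg hs' (q1' j).le) (p2 j)
  · apply le_of_eq
    simp only [Tfun, Finset.mul_sum, ← Finset.sum_add_distrib]
    refine Finset.sum_congr rfl fun n _ => ?_
    rw [hx'']
    simp only
    rw [aux_payoff_comb]
    simp only [Pi.add_apply, Pi.smul_apply, smul_eq_mul]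
    have := (p1 n).ne'
    field_simp
  · funext j
    have h1 := congrArg Prod.fst (huu j)
    simp only [Prod.fst_add, Prod.smul_fst] at h1
    simp only [Afun, Pi.add_apply, Pi.smul_apply] at h1 hxx ⊢
    rw [h1, Finset.sum_congr rfl (fun n _ => hxx n)]
    simp only [Finset.sum_add_distrib, mul_smul, ← Finset.smul_sum, smul_sub]
    abel
  · intro j m
    have h1 := congrFun (congrArg Prod.snd (huu j)) m
    simp only [Prod.snd_add, Prod.smul_snd, Pi.add_apply, Pi.smul_apply, smul_eq_mul] at h1
    have h2 : ∑ n ∈ Nsets j, (s • ω + s' • ω') n * g j n (x'' n) m ≤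
        ∑ n ∈ Nsets j, (s * ω n * g j n (x n) m + s' * ω' n * g j n (x' n) m) :=
      Finset.sum_le_sum fun n _ => aux_comb_le (hg j n m)
        (mul_nonneg hs (hωp n).le) (mul_nonneg hs' (hωp' n).le) (p1 n) _ _
    simp only [Bfun, Pi.add_apply, Pi.smul_apply, smul_eq_mul] at h1 h2 ⊢
    rw [h1]
    simp only [Finset.sum_add_distrib, mul_assoc, ← Finset.mul_sum] at h2 ⊢
    linarith

theorem aux_contg (M : Fin J → ℕ) (Nsets : Fin J → Finset (Fin N))
    (g : (j : Fin J) → Fin N → DVec I1 I2 → Fin (M j) → ℝ)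
    (D : Fin N → Set (DVec I1 I2))
    (U : (j : Fin J) → Set (DVec I1 I2 × (Fin (M j) → ℝ)))
    (W : Set (Fin N → ℝ)) (hassum : GFAssumptions M Nsets g D U W) (j : Fin J) (n : Fin N)
    (m : Fin (M j)) : Continuous (fun x => g j n x m) :=
  (hassum.2.1 j n m).locallyLipschitz.continuous

theorem aux_Kcompact (M : Fin J → ℕ) (Nsets : Fin J → Finset (Fin N))
    (g : (j : Fin J) → Fin N → DVec I1 I2 → Fin (M j) → ℝ)
    (D : Fin N → Set (DVec I1 I2))
    (U : (j : Fin J) → Set (DVec I1 I2 × (Fin (M j) → ℝ)))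
    (W : Set (Fin N → ℝ)) (hassum : GFAssumptions M Nsets g D U W) :
    IsCompact (Kset M D U W) := by
  obtain ⟨hN, hg, -, hD, hU, -, hWc, hWk, hW⟩ := hassum
  exact hWk.prod ((isCompact_univ_pi fun n => (hD n).2.2.2).prod
    (isCompact_univ_pi fun j => (hU j).2.2.2))

theorem aux_contT (M : Fin J → ℕ) (V : Matrix (Fin I1) (Fin I2) ℝ) (π : Fin I2 → ℝ) :
    Continuous (Tfun (N := N) M V π) := by
  refine continuous_finsetSum _ fun n _ => Continuous.mul (by fun_prop) ?_
  exact (aux_cont_payoff V π n).comp (g := fun x : DVec I1 I2 => payoff V π (x.1, x.2, n))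
    (f := fun k : PSpace I1 I2 N J M => k.2.1 n) (by fun_prop)

theorem aux_strong (M : Fin J → ℕ) (Nsets : Fin J → Finset (Fin N))
    (g : (j : Fin J) → Fin N → DVec I1 I2 → Fin (M j) → ℝ)
    (D : Fin N → Set (DVec I1 I2))
    (U : (j : Fin J) → Set (DVec I1 I2 × (Fin (M j) → ℝ)))
    (W : Set (Fin N → ℝ)) (V : Matrix (Fin I1) (Fin I2) ℝ)
    (hassum : GFAssumptions M Nsets g D U W) (π : Fin I2 → ℝ) (hπ : π ∈ stdSimplex ℝ (Fin I2))
    (k0 : PSpace I1 I2 N J M) (hk0 : k0 ∈ Kset M D U W)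
    (hA0 : Afun M Nsets k0 = 0) (hB0 : Bfun M Nsets g k0 ≤ 0) (t : ℝ)
    (ht : ∀ k ∈ Kset M D U W, Afun M Nsets k = 0 → Bfun M Nsets g k ≤ 0 → t < Tfun M V π k) :
    ∃ α β γ, RobustFeas M Nsets g D U W V π (-t) α β γ := by
  have hcg := aux_contg M Nsets g D U W hassum
  obtain ⟨β, γ, hγ, hmain⟩ := aux_sep M (Kset M D U W) (aux_Kcompact M Nsets g D U W hassum)
    (Tfun M V π) (Afun M Nsets) (Bfun M Nsets g) (aux_contT M V π)
    (by unfold Afun; fun_prop)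
    (by
      refine continuous_pi fun j => continuous_pi fun m => ?_
      unfold Bfun
      refine Continuous.sub ?_ (by fun_prop)
      refine continuous_finsetSum _ fun n _ => Continuous.mul (by fun_prop) ?_
      exact (hcg j n m).comp (f := fun k : PSpace I1 I2 N J M => k.2.1 n) (by fun_prop))
    (fun k hk k' hk' s s' => aux_Kconv M Nsets g D U W V hassum π k hk k' hk' s s')
    k0 hk0 hA0 hB0 t ht
  let h : Fin N → DVec I1 I2 → ℝ := fun n x => payoff V π (x.1, x.2, n) +
    ∑ j ∈ univ.filter (fun j : Fin J => n ∈ Nsets j), (dotD (β j) x + ∑ m, γ j m * g j n x m)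
  have hh : ∀ n, Continuous (h n) := by
    intro n
    refine (aux_cont_payoff V π n).add (continuous_finsetSum _ fun j _ => ?_)
    refine (aux_cont_dotD _).add (continuous_finsetSum _ fun m _ => ?_)
    exact continuous_const.mul (hcg j n m)
  obtain ⟨hN, hg, -, hD, hU, -, hWc, hWk, hW⟩ := hassum
  have hmin : ∀ n, ∃ x ∈ D n, IsMinOn (h n) (D n) x := fun n =>
    (hD n).2.2.2.exists_isMinOn (hD n).1 (hh n).continuousOn
  choose x hxD hxmin using hmin
  refine ⟨fun n => - h n (x n), β, γ, hπ, hγ, ?_, ?_⟩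
  · intro ω hω μ ν hU'
    have hpos : ∀ j, 0 < ∑ n ∈ Nsets j, ω n :=
      fun j => Finset.sum_pos (fun n _ => (hW ω hω).1 n) (hN j)
    have := hmain (ω, x, fun j => ((∑ i ∈ Nsets j, ω i)⁻¹ • μ j, (∑ i ∈ Nsets j, ω i)⁻¹ • ν j))
      ⟨hω, fun n _ => hxD n, fun j _ => hU' j⟩
    have e : Tfun M V π (ω, x, fun j =>
          ((∑ i ∈ Nsets j, ω i)⁻¹ • μ j, (∑ i ∈ Nsets j, ω i)⁻¹ • ν j)) +
        ∑ j, (dotD (β j) (Afun M Nsets (ω, x, fun j =>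
          ((∑ i ∈ Nsets j, ω i)⁻¹ • μ j, (∑ i ∈ Nsets j, ω i)⁻¹ • ν j)) j) +
        ∑ m, γ j m * Bfun M Nsets g (ω, x, fun j =>
          ((∑ i ∈ Nsets j, ω i)⁻¹ • μ j, (∑ i ∈ Nsets j, ω i)⁻¹ • ν j)) j m) =
        ∑ n, ω n * h n (x n) - ∑ j, (dotD (β j) (μ j) + ∑ m, γ j m * ν j m) := by
      have e1 : ∑ n, ω n * h n (x n) = Tfun M V π (ω, x, fun j =>
          ((∑ i ∈ Nsets j, ω i)⁻¹ • μ j, (∑ i ∈ Nsets j, ω i)⁻¹ • ν j)) +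
          ∑ j, ∑ n ∈ Nsets j, ω n * (dotD (β j) (x n) + ∑ m, γ j m * g j n (x n) m) := by
        rw [← aux_swap Nsets ω fun j n => dotD (β j) (x n) + ∑ m, γ j m * g j n (x n) m]
        simp only [Tfun]
        rw [← Finset.sum_add_distrib]
        exact Finset.sum_congr rfl fun n _ => mul_add _ _ _
      rw [e1, add_sub_assoc, ← Finset.sum_sub_distrib]
      congr 1
      refine Finset.sum_congr rfl fun j _ => ?_
      have e2 : ∀ m, Bfun M Nsets g (ω, x, fun j =>
          ((∑ i ∈ Nsets j, ω i)⁻¹ • μ j, (∑ i ∈ Nsets j, ω i)⁻¹ • ν j)) j m =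
          ∑ n ∈ Nsets j, ω n * g j n (x n) m - ν j m := by
        intro m
        simp only [Bfun, Pi.smul_apply, smul_eq_mul]
        rw [mul_inv_cancel_left₀ (hpos j).ne']
      have e3 : Afun M Nsets (ω, x, fun j =>
          ((∑ i ∈ Nsets j, ω i)⁻¹ • μ j, (∑ i ∈ Nsets j, ω i)⁻¹ • ν j)) j =
          ∑ n ∈ Nsets j, ω n • x n - μ j := by
        simp only [Afun]
        rw [smul_inv_smul₀ (hpos j).ne']
      simp only [e2, e3, aux_dotD_sub, aux_dotD_sum, aux_dotD_smul, mul_add, mul_sub,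
        Finset.sum_add_distrib, Finset.sum_sub_distrib, Finset.mul_sum]
      rw [Finset.sum_comm (s := Nsets j)]
      have e4 : ∀ m n, γ j m * (ω n * g j n (x n) m) = ω n * (γ j m * g j n (x n) m) := by
        intros; ring
      simp only [e4]
      ring
    rw [e] at this
    have e5 : ∑ n, - h n (x n) * ω n = - ∑ n, ω n * h n (x n) := by
      rw [← Finset.sum_neg_distrib]
      exact Finset.sum_congr rfl fun n _ => by ring
    rw [e5]
    linarith
  · intro n y hy
    have h1 : h n (x n) ≤ h n y := hxmin n hy
    simp only [h] at h1 ⊢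
    linarith

/-- The discrete distribution attached to a point of the finite dimensional primal. -/
def discMeas (ω : Fin N → ℝ) (x : Fin N → DVec I1 I2) : Measure (AmbParam I1 I2 N) :=
  ∑ n, ENNReal.ofReal (ω n) • Measure.dirac ((x n).1, (x n).2, n)

theorem aux_disc_integral (ω : Fin N → ℝ) (hω : ∀ n, 0 ≤ ω n) (x : Fin N → DVec I1 I2)
    (f : AmbParam I1 I2 N → ℝ) :
    ∫ y, f y ∂(discMeas ω x) = ∑ n, ω n * f ((x n).1, (x n).2, n) := by
  unfold discMeas
  rw [integral_finsetSum_measure]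
  · refine Finset.sum_congr rfl fun n _ => ?_
    rw [integral_smul_measure, integral_dirac, ENNReal.toReal_ofReal (hω n), smul_eq_mul]
  · intro n _
    exact (integrable_dirac (by simp)).smul_measure (by simp)

theorem aux_disc_apply (ω : Fin N → ℝ) (x : Fin N → DVec I1 I2) (s : Set (AmbParam I1 I2 N)) :
    discMeas ω x s = ∑ n, ENNReal.ofReal (ω n) * s.indicator 1 ((x n).1, (x n).2, n) := by
  unfold discMeas
  rw [Measure.finsetSum_apply]
  refine Finset.sum_congr rfl fun n _ => ?_
  rw [Measure.smul_apply, Measure.dirac_apply, smul_eq_mul]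

theorem aux_meas_n (p : Fin N → Prop) : MeasurableSet {y : AmbParam I1 I2 N | p y.2.2} := by
  have h : Measurable (fun y : AmbParam I1 I2 N => y.2.2) := by fun_prop
  exact h (MeasurableSet.of_discrete (s := {n | p n}))

theorem aux_disc_setIntegral (ω : Fin N → ℝ) (hω : ∀ n, 0 ≤ ω n) (x : Fin N → DVec I1 I2)
    (f : AmbParam I1 I2 N → ℝ) (S : Finset (Fin N)) :
    ∫ y in {y : AmbParam I1 I2 N | y.2.2 ∈ S}, f y ∂(discMeas ω x)
      = ∑ n ∈ S, ω n * f ((x n).1, (x n).2, n) := by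
  rw [← integral_indicator (aux_meas_n (fun n => n ∈ S)), aux_disc_integral ω hω]
  simp only [Set.indicator_apply, Set.mem_setOf_eq, mul_ite, mul_zero]
  rw [← Finset.sum_filter]
  exact Finset.sum_congr (by ext; simp) fun _ _ => rfl

theorem aux_disc_mem (M : Fin J → ℕ) (Nsets : Fin J → Finset (Fin N))
    (g : (j : Fin J) → Fin N → DVec I1 I2 → Fin (M j) → ℝ)
    (D : Fin N → Set (DVec I1 I2))
    (U : (j : Fin J) → Set (DVec I1 I2 × (Fin (M j) → ℝ)))
    (W : Set (Fin N → ℝ)) (V : Matrix (Fin I1) (Fin I2) ℝ)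
    (hassum : GFAssumptions M Nsets g D U W)
    (k : PSpace I1 I2 N J M) (hk : k ∈ Kset M D U W)
    (hA : Afun M Nsets k = 0) (hB : Bfun M Nsets g k ≤ 0) :
    ∃ P ∈ GeneralFormat M Nsets g D U W, ∀ π : Fin I2 → ℝ,
      ∫ y, payoff V π y ∂((P : ProbabilityMeasure (AmbParam I1 I2 N)) :
        Measure (AmbParam I1 I2 N)) = Tfun M V π k := by
  obtain ⟨ω, x, u⟩ := k
  obtain ⟨hω, hx, hu⟩ := hk
  simp only at hω hx hu
  obtain ⟨hωp, hω1⟩ := hassum.2.2.2.2.2.2.2.2 ω hω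
  have hω0 : ∀ n, 0 ≤ ω n := fun n => (hωp n).le
  have hprob : IsProbabilityMeasure (discMeas ω x) := by
    constructor
    rw [aux_disc_apply]
    simp only [Set.indicator_univ, Pi.one_apply, mul_one]
    rw [← ENNReal.ofReal_sum_of_nonneg (fun n _ => hω0 n), hω1, ENNReal.ofReal_one]
  refine ⟨⟨discMeas ω x, hprob⟩, ?_, ?_⟩
  · refine ⟨ω, hω, fun j => (u j).1, fun j => (u j).2, fun j => hu j trivial, ?_, ?_, ?_, ?_⟩
    · intro j
      have h := congrFun hA j
      simp only [Afun, Pi.zero_apply, sub_eq_zero] at h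
      constructor
      · intro i
        have h1 := congrFun (congrArg Prod.fst h) i
        simp only [Prod.fst_sum, Prod.smul_fst, Finset.sum_apply, Pi.smul_apply, smul_eq_mul] at h1
        rw [← h1]
        exact aux_disc_setIntegral ω hω0 x (fun y => y.1 i) (Nsets j)
      · intro i
        have h1 := congrFun (congrArg Prod.snd h) i
        simp only [Prod.snd_sum, Prod.smul_snd, Finset.sum_apply, Pi.smul_apply, smul_eq_mul] at h1
        rw [← h1]
        exact aux_disc_setIntegral ω hω0 x (fun y => y.2.1 i) (Nsets j)
    · intro j m
      have h := hB j m
      simp only [Bfun, Pi.zero_apply, sub_nonpos] at h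
      refine le_trans (le_of_eq ?_) h
      exact aux_disc_setIntegral ω hω0 x (fun y => g j y.2.2 (y.1, y.2.1) m) (Nsets j)
    · intro n
      change discMeas ω x _ = _
      rw [aux_disc_apply, Finset.sum_eq_single n]
      · rw [Set.indicator_of_mem]
        · simp
        · exact ⟨rfl, hx n trivial⟩
      · intro b _ hb
        rw [Set.indicator_of_notMem]
        · simp
        · exact fun h => hb h.1
      · simp
    · intro n
      change discMeas ω x _ = _
      rw [aux_disc_apply, Finset.sum_eq_single n]
      · rw [Set.indicator_of_mem]
        · simp
        · rfl
      · intro b _ hb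
        rw [Set.indicator_of_notMem]
        · simp
        · exact fun h => hb h
      · simp
  · intro π
    exact aux_disc_integral ω hω0 x (payoff V π)

theorem aux_cont_disc (F : Fin N → DVec I1 I2 → ℝ) (hF : ∀ n, Continuous (F n)) :
    Continuous (fun y : AmbParam I1 I2 N => F y.2.2 (y.1, y.2.1)) := by
  have h : Continuous (fun z : Fin N × DVec I1 I2 => F z.1 z.2) :=
    continuous_prod_of_discrete_left.2 hF
  exact h.comp (f := fun y : AmbParam I1 I2 N => (y.2.2, (y.1, y.2.1))) (by fun_prop)

theorem aux_weak (M : Fin J → ℕ) (Nsets : Fin J → Finset (Fin N))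
    (g : (j : Fin J) → Fin N → DVec I1 I2 → Fin (M j) → ℝ)
    (D : Fin N → Set (DVec I1 I2))
    (U : (j : Fin J) → Set (DVec I1 I2 × (Fin (M j) → ℝ)))
    (W : Set (Fin N → ℝ)) (V : Matrix (Fin I1) (Fin I2) ℝ)
    (hassum : GFAssumptions M Nsets g D U W) (π : Fin I2 → ℝ) (δ : ℝ) (α : Fin N → ℝ)
    (β : Fin J → DVec I1 I2) (γ : (j : Fin J) → Fin (M j) → ℝ)
    (hfeas : RobustFeas M Nsets g D U W V π δ α β γ)
    (P : ProbabilityMeasure (AmbParam I1 I2 N)) (hP : P ∈ GeneralFormat M Nsets g D U W) :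
    -δ ≤ ∫ y, payoff V π y ∂(P : Measure (AmbParam I1 I2 N)) := by
  have hcg := aux_contg M Nsets g D U W hassum
  obtain ⟨hN, hg, -, hD, hU, -, hWc, hWk, hW⟩ := hassum
  obtain ⟨ω, hω, μ, ν, hμν, hmean, hgν, hPD, hPn⟩ := hP
  obtain ⟨-, hγ, hi, hii⟩ := hfeas
  set Q : Measure (AmbParam I1 I2 N) := (P : Measure (AmbParam I1 I2 N)) with hQ
  have hpos : ∀ j, 0 < ∑ n ∈ Nsets j, ω n :=
    fun j => Finset.sum_pos (fun n _ => (hW ω hω).1 n) (hN j)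
  let KK : Set (AmbParam I1 I2 N) := {y | (y.1, y.2.1) ∈ D y.2.2}
  have hKK : IsCompact KK := by
    have : KK = ⋃ n, (fun x : DVec I1 I2 => ((x.1, x.2, n) : AmbParam I1 I2 N)) '' D n := by
      ext ⟨p, r, n⟩
      simp [KK]
    rw [this]
    exact isCompact_iUnion fun n => (hD n).2.2.2.image (by fun_prop)
  have hae : ∀ᵐ y ∂Q, y ∈ KK := by
    have h1 : ∀ n, ∀ᵐ y ∂Q, y.2.2 = n → (y.1, y.2.1) ∈ D n := by
      intro n
      have hm : MeasurableSet {y : AmbParam I1 I2 N | y.2.2 = n ∧ (y.1, y.2.1) ∈ D n} := by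
        refine (aux_meas_n (fun k => k = n)).inter ?_
        have : Measurable (fun y : AmbParam I1 I2 N => (y.1, y.2.1)) := by fun_prop
        exact this (hD n).2.1.measurableSet
      have h2 := measure_diff (μ := Q) (s₁ := {y : AmbParam I1 I2 N | y.2.2 = n})
        (s₂ := {y : AmbParam I1 I2 N | y.2.2 = n ∧ (y.1, y.2.1) ∈ D n})
        (fun y hy => hy.1) hm.nullMeasurableSet (measure_ne_top _ _)
      rw [hPD, hPn, tsub_self] at h2
      rw [ae_iff]
      refine measure_mono_null ?_ h2
      intro y hy
      simp only [Set.mem_setOf_eq, Classical.not_imp] at hy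
      exact ⟨hy.1, fun h => hy.2 h.2⟩
    filter_upwards [ae_all_iff.2 h1] with y hy
    exact hy y.2.2 rfl
  have hInteg : ∀ f : AmbParam I1 I2 N → ℝ, Continuous f → Integrable f Q := by
    intro f hf
    have := hf.continuousOn.integrableOn_compact (μ := Q) hKK
    rwa [IntegrableOn, Measure.restrict_eq_self_of_ae_mem hae] at this
  let s : Fin J → Set (AmbParam I1 I2 N) := fun j => {y | y.2.2 ∈ Nsets j}
  have hs : ∀ j, MeasurableSet (s j) := fun j => aux_meas_n (fun n => n ∈ Nsets j)
  let q : Fin J → AmbParam I1 I2 N → ℝ := fun j y =>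
    dotD (β j) (y.1, y.2.1) + ∑ m, γ j m * g j y.2.2 (y.1, y.2.1) m
  have cp : Continuous (payoff V π : AmbParam I1 I2 N → ℝ) := by
    unfold payoff; fun_prop
  have cα : Continuous (fun y : AmbParam I1 I2 N => α y.2.2) :=
    aux_cont_disc (fun n _ => α n) fun n => continuous_const
  have cgy : ∀ j m, Continuous (fun y : AmbParam I1 I2 N => g j y.2.2 (y.1, y.2.1) m) :=
    fun j m => aux_cont_disc (fun n x => g j n x m) fun n => hcg j n m
  have cd : ∀ j, Continuous (fun y : AmbParam I1 I2 N => dotD (β j) (y.1, y.2.1)) :=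
    fun j => aux_cont_disc (fun n x => dotD (β j) x) fun n => aux_cont_dotD _
  have cγg : ∀ j m, Continuous (fun y : AmbParam I1 I2 N => γ j m * g j y.2.2 (y.1, y.2.1) m) :=
    fun j m => continuous_const.mul (cgy j m)
  have cγ : ∀ j, Continuous
      (fun y : AmbParam I1 I2 N => ∑ m, γ j m * g j y.2.2 (y.1, y.2.1) m) :=
    fun j => continuous_finsetSum _ fun m _ => cγg j m
  have cq : ∀ j, Continuous (q j) := fun j =>
    (cd j).add (continuous_finsetSum _ fun m _ => continuous_const.mul (cgy j m))
  have hnn : 0 ≤ ∫ y, (payoff V π y + α y.2.2 + ∑ j, (s j).indicator (q j) y) ∂Q := by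
    refine integral_nonneg_of_ae ?_
    filter_upwards [hae] with y hy
    have := hii y.2.2 (y.1, y.2.1) hy
    have e : ∑ j, (s j).indicator (q j) y =
      ∑ j ∈ univ.filter (fun j : Fin J => y.2.2 ∈ Nsets j), q j y := by
      rw [Finset.sum_filter]
      refine Finset.sum_congr rfl fun j _ => ?_
      by_cases hj : y.2.2 ∈ Nsets j
      · rw [if_pos hj, Set.indicator_of_mem (show y ∈ s j from hj)]
      · rw [if_neg hj, Set.indicator_of_notMem (show y ∉ s j from hj)]
    simp only [Pi.zero_apply]
    rw [e]
    simp only [q]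
    have e2 : payoff V π y = payoff V π (y.1, y.2.1, y.2.2) := rfl
    rw [e2]
    linarith
  have hα : ∫ y, α y.2.2 ∂Q = ∑ n, α n * ω n := by
    have e : ∀ y : AmbParam I1 I2 N, α y.2.2 =
        ∑ n, {y : AmbParam I1 I2 N | y.2.2 = n}.indicator (fun _ => α n) y := by
      intro y
      simp [Set.indicator_apply]
    simp_rw [e]
    rw [integral_finsetSum]
    · refine Finset.sum_congr rfl fun n _ => ?_
      rw [integral_indicator_const _ (aux_meas_n (fun k => k = n)), measureReal_def, hPn,
        ENNReal.toReal_ofReal ((hW ω hω).1 n).le, smul_eq_mul, mul_comm]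
    · intro n _
      exact (integrable_const _).indicator (aux_meas_n (fun k => k = n))
  have hq : ∀ j, ∫ y, (s j).indicator (q j) y ∂Q ≤
      dotD (β j) ((∑ n ∈ Nsets j, ω n) • μ j) + ∑ m, γ j m * ((∑ n ∈ Nsets j, ω n) • ν j) m := by
    intro j
    rw [integral_indicator (hs j)]
    have hInteg' : ∀ f : AmbParam I1 I2 N → ℝ, Continuous f → Integrable f (Q.restrict (s j)) :=
      fun f hf => (hInteg f hf).integrableOn
    simp only [q]
    rw [integral_add (hInteg' _ (cd j)) (hInteg' _ (cγ j))]
    refine add_le_add (le_of_eq ?_) ?_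
    · simp only [dotD]
      rw [integral_add (hInteg' _ (by fun_prop)) (hInteg' _ (by fun_prop)),
        integral_finsetSum _ (fun i _ => hInteg' _ (by fun_prop)),
        integral_finsetSum _ (fun i _ => hInteg' _ (by fun_prop))]
      simp only [integral_const_mul]
      congr 1
      · exact Finset.sum_congr rfl fun i _ => congrArg _ ((hmean j).1 i)
      · exact Finset.sum_congr rfl fun i _ => congrArg _ ((hmean j).2 i)
    · rw [integral_finsetSum _ (fun m _ => hInteg' _ (cγg j m))]
      simp only [integral_const_mul]
      exact Finset.sum_le_sum fun m _ => mul_le_mul_of_nonneg_left (hgν j m) (hγ j m)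
  have hi' := hi ω hω (fun j => (∑ n ∈ Nsets j, ω n) • μ j) (fun j => (∑ n ∈ Nsets j, ω n) • ν j)
    (by
      intro j
      rw [inv_smul_smul₀ (hpos j).ne', inv_smul_smul₀ (hpos j).ne']
      exact hμν j)
  have hpa : Integrable (fun y => payoff V π y + α y.2.2) Q := (hInteg _ cp).add (hInteg _ cα)
  rw [integral_add hpa
    (integrable_finsetSum _ fun j _ => (hInteg _ (cq j)).indicator (hs j)),
    integral_add (hInteg _ cp) (hInteg _ cα), hα,
    integral_finsetSum _ fun j _ => (hInteg _ (cq j)).indicator (hs j)] at hnn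
  have := Finset.sum_le_sum fun j (_ : j ∈ univ) => hq j
  linarith

theorem aux_slater (M : Fin J → ℕ) (Nsets : Fin J → Finset (Fin N))
    (g : (j : Fin J) → Fin N → DVec I1 I2 → Fin (M j) → ℝ)
    (D : Fin N → Set (DVec I1 I2))
    (U : (j : Fin J) → Set (DVec I1 I2 × (Fin (M j) → ℝ)))
    (W : Set (Fin N → ℝ)) (hassum : GFAssumptions M Nsets g D U W)
    (h : (SlaterSystem M Nsets g D U W).Nonempty) :
    ∃ k ∈ Kset M D U W, Afun M Nsets k = 0 ∧ Bfun M Nsets g k ≤ 0 := by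
  obtain ⟨⟨τ, ξ, ζ, φ⟩, hτ, h1, h2, h3, h4, h5⟩ := h
  simp only at hτ h1 h2 h3 h4 h5
  obtain ⟨hN, hg, -, hD, hU, -, hWc, hWk, hW⟩ := hassum
  have hp := (hW τ hτ).1
  have hpos : ∀ j, 0 < ∑ n ∈ Nsets j, τ n :=
    fun j => Finset.sum_pos (fun n _ => hp n) (hN j)
  refine ⟨(τ, fun n => (τ n)⁻¹ • ξ n, fun j => (∑ i ∈ Nsets j, τ i)⁻¹ • φ j),
    ⟨hτ, fun n _ => h4 n, fun j _ => h5 j⟩, ?_, ?_⟩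
  · funext j
    simp only [Afun, Prod.smul_fst, Pi.zero_apply]
    rw [smul_inv_smul₀ (hpos j).ne', ← h1 j, sub_eq_zero]
    exact Finset.sum_congr rfl fun n _ => smul_inv_smul₀ (hp n).ne' _
  · intro j m
    simp only [Bfun, Prod.smul_snd, Pi.zero_apply, Pi.smul_apply, smul_eq_mul]
    rw [mul_inv_cancel_left₀ (hpos j).ne', sub_nonpos]
    refine le_trans (Finset.sum_le_sum fun n hn => ?_) (h2 j m)
    have := mul_le_mul_of_nonneg_left (h3 n j hn m) (hp n).le
    rwa [mul_inv_cancel_left₀ (hp n).ne'] at this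

/-- under Slater's condition for system (2.3), the S-robust one-stage
problem (3.1) and the classical robust optimization problem (3.2) have the same optimal
value, and the `π`-component of any optimal solution of (3.2) is optimal for (3.1). -/
theorem S_robust_action_reformulation
    (M : Fin J → ℕ) (Nsets : Fin J → Finset (Fin N))
    (g : (j : Fin J) → Fin N → DVec I1 I2 → Fin (M j) → ℝ)
    (D : Fin N → Set (DVec I1 I2))
    (U : (j : Fin J) → Set (DVec I1 I2 × (Fin (M j) → ℝ)))
    (W : Set (Fin N → ℝ)) (V : Matrix (Fin I1) (Fin I2) ℝ)
    (hassum : GFAssumptions M Nsets g D U W)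
    (hslater : (intrinsicInterior ℝ (SlaterSystem M Nsets g D U W)).Nonempty) :
    primalValue M Nsets g D U W V = dualValue M Nsets g D U W V ∧
      ∀ π δ α β γv, RobustFeas M Nsets g D U W V π δ α β γv →
        -δ = dualValue M Nsets g D U W V →
        (⨅ P : GeneralFormat M Nsets g D U W,
            ∫ y, payoff V π y
              ∂((P : ProbabilityMeasure (AmbParam I1 I2 N)) : Measure (AmbParam I1 I2 N)))
          = primalValue M Nsets g D U W V := by
  obtain ⟨k0, hk0, hA0, hB0⟩ :=
    aux_slater M Nsets g D U W hassum (hslater.mono intrinsicInterior_subset)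
  obtain ⟨P0, hP0, hP0T⟩ := aux_disc_mem M Nsets g D U W V hassum k0 hk0 hA0 hB0
  haveI : Nonempty (GeneralFormat M Nsets g D U W) := ⟨⟨P0, hP0⟩⟩
  let F : (Fin I2 → ℝ) → ℝ := fun π => ⨅ P : GeneralFormat M Nsets g D U W,
    ∫ y, payoff V π y
      ∂((P : ProbabilityMeasure (AmbParam I1 I2 N)) : Measure (AmbParam I1 I2 N))
  have hweak : ∀ π δ α β γv, RobustFeas M Nsets g D U W V π δ α β γv → -δ ≤ F π := by
    intro π δ α β γv h
    exact le_ciInf fun P => aux_weak M Nsets g D U W V hassum π δ α β γv h P.1 P.2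
  have hbdd : ∀ π ∈ stdSimplex ℝ (Fin I2), BddBelow (Set.range
      fun P : GeneralFormat M Nsets g D U W => ∫ y, payoff V π y
        ∂((P : ProbabilityMeasure (AmbParam I1 I2 N)) : Measure (AmbParam I1 I2 N))) := by
    intro π hπ
    obtain ⟨c, hc⟩ := (aux_Kcompact M Nsets g D U W hassum).bddBelow_image
      (aux_contT M V π).continuousOn
    obtain ⟨α, β, γv, h⟩ := aux_strong M Nsets g D U W V hassum π hπ k0 hk0 hA0 hB0 (c - 1)
      (fun k hk _ _ => by
        have := hc (Set.mem_image_of_mem _ hk)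
        linarith)
    refine ⟨- -(c - 1), ?_⟩
    rintro _ ⟨P, rfl⟩
    exact aux_weak M Nsets g D U W V hassum π _ α β γv h P.1 P.2
  have hstrong : ∀ π ∈ stdSimplex ℝ (Fin I2), ∀ t < F π,
      ∃ α β γv, RobustFeas M Nsets g D U W V π (-t) α β γv := by
    intro π hπ t ht
    refine aux_strong M Nsets g D U W V hassum π hπ k0 hk0 hA0 hB0 t ?_
    intro k hk hA hB
    obtain ⟨P, hP, hPT⟩ := aux_disc_mem M Nsets g D U W V hassum k hk hA hB
    rw [← hPT π]
    exact ht.trans_le (ciInf_le (hbdd π hπ) ⟨P, hP⟩)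
  obtain ⟨c, hc⟩ : ∃ c, ∀ π ∈ stdSimplex ℝ (Fin I2), F π ≤ c := by
    have hcont : Continuous fun π : Fin I2 → ℝ => Tfun M V π k0 := by
      unfold Tfun payoff
      fun_prop
    obtain ⟨c, hc⟩ := (isCompact_stdSimplex ℝ (Fin I2)).bddAbove_image hcont.continuousOn
    refine ⟨c, fun π hπ => ?_⟩
    refine le_trans (ciInf_le (hbdd π hπ) ⟨P0, hP0⟩) ?_
    rw [hP0T π]
    exact hc (Set.mem_image_of_mem _ hπ)
  have hbF : BddAbove (Set.range fun π : stdSimplex ℝ (Fin I2) => F π) := by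
    refine ⟨c, ?_⟩
    rintro _ ⟨π, rfl⟩
    exact hc π π.2
  have hbD : BddAbove {x : ℝ | ∃ π δ α β γv, RobustFeas M Nsets g D U W V π δ α β γv ∧
      x = -δ} := by
    refine ⟨c, ?_⟩
    rintro _ ⟨π, δ, α, β, γv, h, rfl⟩
    exact (hweak π δ α β γv h).trans (hc π h.1)
  have hpv : primalValue M Nsets g D U W V = ⨆ π : stdSimplex ℝ (Fin I2), F π := rfl
  have heq : primalValue M Nsets g D U W V = dualValue M Nsets g D U W V := by
    rw [hpv, dualValue]
    rcases isEmpty_or_nonempty (stdSimplex ℝ (Fin I2)) with hE | hE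
    · rw [Real.iSup_of_isEmpty]
      have : {x : ℝ | ∃ π δ α β γv, RobustFeas M Nsets g D U W V π δ α β γv ∧
          x = -δ} = ∅ := by
        ext x
        simp only [Set.mem_setOf_eq, Set.mem_empty_iff_false, iff_false]
        rintro ⟨π, δ, α, β, γv, h, rfl⟩
        exact hE.false ⟨π, h.1⟩
      rw [this, Real.sSup_empty]
    · apply le_antisymm
      · refine ciSup_le fun π => le_of_forall_lt fun t ht => ?_
        obtain ⟨t', ht1, ht2⟩ := exists_between ht
        obtain ⟨α, β, γv, h⟩ := hstrong π π.2 t' ht2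
        exact ht1.trans_le (le_csSup hbD ⟨π, -t', α, β, γv, h, by simp⟩)
      · obtain ⟨π⟩ := hE
        obtain ⟨α, β, γv, h⟩ := hstrong π π.2 (F π - 1) (by linarith)
        refine csSup_le ⟨_, π, _, α, β, γv, h, rfl⟩ ?_
        rintro _ ⟨π, δ, α, β, γv, h, rfl⟩
        exact (hweak π δ α β γv h).trans (le_ciSup hbF ⟨π, h.1⟩)
  refine ⟨heq, fun π δ α β γv h hd => le_antisymm ?_ ?_⟩
  · rw [hpv]
    exact le_ciSup hbF ⟨π, h.1⟩
  · rw [heq, ← hd]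
    exact hweak π δ α β γv h

end
end

section
/- The lifted ambiguity set G in the general format is compact in the topology of weak convergence of probability measures: G is weakly closed, and since all of its member distributions are supported on the compact set (∪_{n∈[N]} D_n) × [N], it is tight and hence weakly compact. -/
open MeasureTheory Finset ENNReal

noncomputable section

variable {I1 I2 N J : ℕ}

lemma exists_bcf_of_compact {X : Type*} [TopologicalSpace X] [MeasurableSpace X] [BorelSpace X]
    {K A : Set X} (hK : IsCompact K) (hA : IsClopen A) {f : X → ℝ} (hf : Continuous f) :
    ∃ h : BoundedContinuousFunction X ℝ, ∀ P : ProbabilityMeasure X,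
      (P : Measure X) Kᶜ = 0 →
        ∫ y in A, f y ∂(P : Measure X) = ∫ y, h y ∂(P : Measure X) := by
  obtain ⟨C, hC⟩ := hK.exists_bound_of_continuousOn hf.continuousOn
  have hcont : Continuous (A.indicator (fun y => max (-|C|) (min |C| (f y)))) :=
    (continuous_const.max (continuous_const.min hf)).indicator (by simp [hA.frontier_eq])
  refine ⟨BoundedContinuousFunction.ofNormedAddCommGroup _ hcont |C| ?_, ?_⟩
  · intro y
    by_cases hy : y ∈ A
    · rw [Set.indicator_of_mem hy, Real.norm_eq_abs, abs_le]
      have := abs_nonneg C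
      exact ⟨le_max_left _ _, max_le (by linarith) (min_le_left _ _)⟩
    · rw [Set.indicator_of_notMem hy]; simp
  · intro P hP
    rw [← integral_indicator hA.isOpen.measurableSet]
    apply integral_congr_ae
    have hP' : ∀ᵐ y ∂(P : Measure X), y ∈ K := hP
    filter_upwards [hP'] with y hy
    simp only [BoundedContinuousFunction.coe_ofNormedAddCommGroup]
    by_cases hyA : y ∈ A
    · rw [Set.indicator_of_mem hyA, Set.indicator_of_mem hyA]
      have h1 := hC y hy
      rw [Real.norm_eq_abs] at h1
      have h2 := abs_le.1 (h1.trans (le_abs_self C))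
      rw [min_eq_right h2.2, max_eq_right h2.1]
    · rw [Set.indicator_of_notMem hyA, Set.indicator_of_notMem hyA]

lemma isCompact_supported {X : Type*} [TopologicalSpace X] [T2Space X] [MeasurableSpace X]
    [BorelSpace X] {K : Set X} (hK : IsCompact K) :
    IsCompact {P : ProbabilityMeasure X | (P : Measure X) Kᶜ = 0} := by
  have h := isCompact_setOfPred_probabilityMeasure_mass_eq_compl_isCompact_le (E := X)
    (u := fun _ => 0) (K := fun _ => K) tendsto_const_nhds (fun _ => hK)
    (Or.inr monotone_const)
  convert h using 1
  ext P
  simp only [Set.mem_ofPred_eq, nonpos_iff_eq_zero, forall_const]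
  exact P.null_iff_toMeasure_null _ |>.symm

lemma continuous_bcf_integral {X : Type*} [TopologicalSpace X] [MeasurableSpace X]
    [BorelSpace X] (h : BoundedContinuousFunction X ℝ) :
    Continuous (fun P : ProbabilityMeasure X => ∫ y, h y ∂(P : Measure X)) :=
  continuous_iff_continuousAt.2 fun _ =>
    (ProbabilityMeasure.tendsto_iff_forall_integral_tendsto.1 Filter.tendsto_id) h

lemma isClopen_scenario (A : Set (Fin N)) :
    IsClopen {y : AmbParam I1 I2 N | y.2.2 ∈ A} :=
  (isClopen_discrete A).preimage (continuous_snd.comp continuous_snd)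

def suppSet (D : Fin N → Set (DVec I1 I2)) : Set (AmbParam I1 I2 N) :=
  {y | (y.1, y.2.1) ∈ D y.2.2}

lemma isCompact_suppSet {D : Fin N → Set (DVec I1 I2)} (hD : ∀ n, IsCompact (D n)) :
    IsCompact (suppSet D) := by
  have : suppSet D = ⋃ n, (fun x : DVec I1 I2 => ((x.1, x.2, n) : AmbParam I1 I2 N)) '' D n := by
    ext ⟨a, b, n⟩
    simp [suppSet]
  rw [this]
  exact isCompact_iUnion fun n => (hD n).image (by fun_prop)

lemma continuous_scenario {f : Fin N → DVec I1 I2 → ℝ} (hf : ∀ n, Continuous (f n)) :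
    Continuous (fun y : AmbParam I1 I2 N => f y.2.2 (y.1, y.2.1)) := by
  have h : Continuous (fun z : Fin N × DVec I1 I2 => f z.1 z.2) :=
    continuous_prod_of_discrete_left.2 hf
  exact h.comp (by fun_prop : Continuous (fun y : AmbParam I1 I2 N => (y.2.2, (y.1, y.2.1))))

lemma supp_iff (D : Fin N → Set (DVec I1 I2)) (hD : ∀ n, IsCompact (D n))
    (P : ProbabilityMeasure (AmbParam I1 I2 N)) :
    (P : Measure (AmbParam I1 I2 N)) (suppSet D)ᶜ = 0 ↔
      ∀ n, (P : Measure (AmbParam I1 I2 N)) {y | y.2.2 = n ∧ (y.1, y.2.1) ∈ D n}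
        = (P : Measure (AmbParam I1 I2 N)) {y | y.2.2 = n} := by
  have hm : MeasurableSet (suppSet D) := (isCompact_suppSet hD).isClosed.measurableSet
  have key : ∀ n, {y : AmbParam I1 I2 N | y.2.2 = n ∧ (y.1, y.2.1) ∈ D n}
      = {y | y.2.2 = n} ∩ suppSet D := by
    intro n; ext y
    simp only [suppSet, Set.mem_ofPred_eq, Set.mem_inter_iff]
    constructor
    · rintro ⟨rfl, h⟩; exact ⟨rfl, h⟩
    · rintro ⟨rfl, h⟩; exact ⟨rfl, h⟩
  constructor
  · intro h n
    rw [key]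
    exact measure_inter_conull h
  · intro h
    have hU : (suppSet D)ᶜ = ⋃ n, ({y : AmbParam I1 I2 N | y.2.2 = n} \ suppSet D) := by
      ext y; simp
    rw [hU, measure_iUnion_null_iff]
    intro n
    have h1 := measure_inter_add_sdiff (μ := (P : Measure (AmbParam I1 I2 N)))
      {y : AmbParam I1 I2 N | y.2.2 = n} hm
    rw [← key, h n] at h1
    have hfin := measure_ne_top (P : Measure (AmbParam I1 I2 N)) {y | y.2.2 = n}
    exact (ENNReal.add_right_inj hfin).1 (h1.trans (add_zero _).symm)

/-- the lifted ambiguity set `G` in the general format is weakly closed and,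
since all its member distributions are supported on the compact set
`(∪_{n∈[N]} D_n) × [N]`, it is weakly compact (in the topology of weak convergence on
probability measures). -/
theorem general_format_weakly_compact
    (M : Fin J → ℕ) (Nsets : Fin J → Finset (Fin N))
    (g : (j : Fin J) → Fin N → DVec I1 I2 → Fin (M j) → ℝ)
    (D : Fin N → Set (DVec I1 I2))
    (U : (j : Fin J) → Set (DVec I1 I2 × (Fin (M j) → ℝ)))
    (W : Set (Fin N → ℝ))
    (hassum : GFAssumptions M Nsets g D U W) :
    IsClosed (GeneralFormat M Nsets g D U W) ∧
      (∀ P ∈ GeneralFormat M Nsets g D U W,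
        (P : Measure (AmbParam I1 I2 N))
          {y : AmbParam I1 I2 N | (y.1, y.2.1) ∈ ⋃ n, D n} = 1) ∧
      IsCompact (GeneralFormat M Nsets g D U W) := by
  obtain ⟨-, hconv, -, hD, hU, -, -, hWc, hWpos⟩ := hassum
  have hDc : ∀ n, IsCompact (D n) := fun n => (hD n).2.2.2
  have hUc : ∀ j, IsCompact (U j) := fun j => (hU j).2.2.2
  have hK := isCompact_suppSet hDc
  have hg : ∀ j n m, Continuous (fun x => g j n x m) := fun j n m =>
    continuousOn_univ.1 ((hconv j n m).continuousOn isOpen_univ)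
  have hcl : ∀ j, IsClopen {y : AmbParam I1 I2 N | y.2.2 ∈ Nsets j} := fun j =>
    isClopen_scenario (Nsets j : Set (Fin N))
  have hcl' : ∀ n, IsClopen {y : AmbParam I1 I2 N | y.2.2 = n} := fun n =>
    isClopen_scenario ({n} : Set (Fin N))
  choose h1 hh1 using fun (j : Fin J) (i : Fin I1) => exists_bcf_of_compact hK (hcl j)
    (f := fun y : AmbParam I1 I2 N => y.1 i) (by fun_prop)
  choose h2 hh2 using fun (j : Fin J) (i : Fin I2) => exists_bcf_of_compact hK (hcl j)
    (f := fun y : AmbParam I1 I2 N => y.2.1 i) (by fun_prop)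
  choose h3 hh3 using fun (j : Fin J) (m : Fin (M j)) => exists_bcf_of_compact hK (hcl j)
    (f := fun y : AmbParam I1 I2 N => g j y.2.2 (y.1, y.2.1) m)
    (continuous_scenario (f := fun n x => g j n x m) (fun n => hg j n m))
  choose h4 hh4 using fun (n : Fin N) => exists_bcf_of_compact hK (hcl' n)
    (f := fun _ : AmbParam I1 I2 N => (1 : ℝ)) continuous_const
  let T := ProbabilityMeasure (AmbParam I1 I2 N) × (Fin N → ℝ) ×
    ((j : Fin J) → DVec I1 I2 × (Fin (M j) → ℝ))
  let S0 : Set T := {P : ProbabilityMeasure (AmbParam I1 I2 N) |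
      (P : Measure (AmbParam I1 I2 N)) (suppSet D)ᶜ = 0} ×ˢ (W ×ˢ Set.univ.pi U)
  let S1 : Set T := {t | (∀ j i, ∫ y, h1 j i y ∂(t.1 : Measure (AmbParam I1 I2 N))
        = (∑ i' ∈ Nsets j, t.2.1 i') * (t.2.2 j).1.1 i)
      ∧ (∀ j i, ∫ y, h2 j i y ∂(t.1 : Measure (AmbParam I1 I2 N))
        = (∑ i' ∈ Nsets j, t.2.1 i') * (t.2.2 j).1.2 i)
      ∧ (∀ j m, ∫ y, h3 j m y ∂(t.1 : Measure (AmbParam I1 I2 N))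
        ≤ (∑ i' ∈ Nsets j, t.2.1 i') * (t.2.2 j).2 m)
      ∧ (∀ n, ∫ y, h4 n y ∂(t.1 : Measure (AmbParam I1 I2 N)) = t.2.1 n)}
  have hS0 : IsCompact S0 :=
    (isCompact_supported hK).prod (hWc.prod (isCompact_univ_pi hUc))
  have hint : ∀ h : BoundedContinuousFunction (AmbParam I1 I2 N) ℝ,
      Continuous (fun t : T => ∫ y, h y ∂(t.1 : Measure (AmbParam I1 I2 N))) := fun h =>
    (continuous_bcf_integral h).comp continuous_fst
  have hS1 : IsClosed S1 := by
    simp only [S1, Set.ofPred_and, Set.ofPred_forall]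
    refine IsClosed.inter ?_ (IsClosed.inter ?_ (IsClosed.inter ?_ ?_))
    · exact isClosed_iInter fun j => isClosed_iInter fun i =>
        isClosed_eq (hint _) (by fun_prop)
    · exact isClosed_iInter fun j => isClosed_iInter fun i =>
        isClosed_eq (hint _) (by fun_prop)
    · exact isClosed_iInter fun j => isClosed_iInter fun i =>
        isClosed_le (hint _) (by fun_prop)
    · exact isClosed_iInter fun j => isClosed_eq (hint _) (by fun_prop)
  have hmass : ∀ P : ProbabilityMeasure (AmbParam I1 I2 N),
      (P : Measure (AmbParam I1 I2 N)) (suppSet D)ᶜ = 0 → ∀ ω ∈ W, ∀ n,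
      ((P : Measure (AmbParam I1 I2 N)) {y | y.2.2 = n} = ENNReal.ofReal (ω n) ↔
        ∫ y, h4 n y ∂(P : Measure (AmbParam I1 I2 N)) = ω n) := by
    intro P hP ω hω n
    have hpos := ((hWpos ω hω).1 n).le
    rw [← hh4 n P hP, setIntegral_const, smul_eq_mul, mul_one, Measure.real]
    constructor
    · intro h; rw [h, ENNReal.toReal_ofReal hpos]
    · intro h; rw [← h, ENNReal.ofReal_toReal (measure_ne_top _ _)]
  have hsupp : ∀ P ∈ GeneralFormat M Nsets g D U W,
      (P : Measure (AmbParam I1 I2 N)) (suppSet D)ᶜ = 0 := by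
    rintro P ⟨ω, -, μ, ν, -, -, -, hPD, hPn⟩
    exact (supp_iff D hDc P).2 fun n => (hPD n).trans (hPn n).symm
  have hEq : GeneralFormat M Nsets g D U W = Prod.fst '' (S0 ∩ S1) := by
    ext P
    constructor
    · intro hPG
      have hP := hsupp P hPG
      obtain ⟨ω, hω, μ, ν, hμν, hE, hG, hPD, hPn⟩ := hPG
      refine ⟨(P, ω, fun j => (μ j, ν j)), ⟨⟨hP, hω, fun j _ => hμν j⟩, ?_, ?_, ?_, ?_⟩, rfl⟩
      · intro j i; exact (hh1 j i P hP).symm.trans ((hE j).1 i)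
      · intro j i; exact (hh2 j i P hP).symm.trans ((hE j).2 i)
      · intro j m; exact (hh3 j m P hP).symm.le.trans (hG j m)
      · intro n; exact (hmass P hP ω hω n).1 (hPn n)
    · rintro ⟨⟨Q, ω, u⟩, ⟨⟨hP, hω, hu⟩, hA, hB, hC, hE⟩, rfl⟩
      have hPn := fun n => (hmass Q hP ω hω n).2 (hE n)
      refine ⟨ω, hω, fun j => (u j).1, fun j => (u j).2, fun j => hu j trivial, ?_, ?_, ?_, hPn⟩
      · intro j
        exact ⟨fun i => (hh1 j i Q hP).trans (hA j i), fun i => (hh2 j i Q hP).trans (hB j i)⟩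
      · intro j m; exact (hh3 j m Q hP).le.trans (hC j m)
      · intro n; exact ((supp_iff D hDc Q).1 hP n).trans (hPn n)
  have hcomp : IsCompact (GeneralFormat M Nsets g D U W) := by
    rw [hEq]
    exact (hS0.inter_right hS1).image continuous_fst
  refine ⟨hcomp.isClosed, ?_, hcomp⟩
  intro P hP
  have hae : ∀ᵐ y ∂(P : Measure (AmbParam I1 I2 N)), y ∈ suppSet D := hsupp P hP
  rw [← measure_univ (μ := (P : Measure (AmbParam I1 I2 N)))]
  refine measure_congr (Filter.eventuallyEq_univ.2 ?_)
  filter_upwards [hae] with y hy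
  exact Set.mem_iUnion.2 ⟨y.2.2, hy⟩

end
end
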